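/- arXiv:1805.07725 — 2 statements merged into one kernel-verified Lean document; each statement's English description precedes it below -/
import Mathlib

section
/- For every finite set of (possibly overlapping) tiles T over rows [n] and columns [m], there exists a tiling 𝒯 (a finite set of pairwise non-overlapping tiles) that is equivalent to T, i.e., a vector of permutations is allowed by 𝒯 if and only if it is allowed by T. -/
/-- A tile is a pair `(R, C)` with `R ⊆ [n]` and `C ⊆ [m]`. -/
def allowedByTile {n m : ℕ} (P : Fin m → Equiv.Perm (Fin n))
    (t : Set (Fin n) × Set (Fin m)) : Prop :=
  ∀ i : Fin n, ∀ j j' : Fin m,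
    i ∈ t.1 → j ∈ t.2 → j' ∈ t.2 → P j i ∈ t.1 ∧ P j i = P j' i

/-- A vector of permutations is allowed by a set of tiles iff it is allowed by every tile. -/
def allowedBySet {n m : ℕ} (P : Fin m → Equiv.Perm (Fin n))
    (T : Set (Set (Fin n) × Set (Fin m))) : Prop :=
  ∀ t ∈ T, allowedByTile P t

/-- Two tiles overlap iff both their row sets and their column sets intersect. -/
def TilesOverlap {n m : ℕ} (t t' : Set (Fin n) × Set (Fin m)) : Prop :=
  (t.1 ∩ t'.1).Nonempty ∧ (t.2 ∩ t'.2).Nonempty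

/-- Two columns are adjacent in row `i` when some tile of `T` covers both of them in that row. -/
def ColAdj {n m : ℕ} (T : Set (Set (Fin n) × Set (Fin m))) (i : Fin n) (j l : Fin m) : Prop :=
  ∃ t ∈ T, i ∈ t.1 ∧ j ∈ t.2 ∧ l ∈ t.2

/-- Two columns are connected in row `i`. -/
def ColConn {n m : ℕ} (T : Set (Set (Fin n) × Set (Fin m))) (i : Fin n) :
    Fin m → Fin m → Prop :=
  Relation.ReflTransGen (ColAdj T i)

/-- Rows `i` and `k` lie in the same tiles among those that meet the component of `j` in row `i`. -/
def RowSim {n m : ℕ} (T : Set (Set (Fin n) × Set (Fin m))) (j : Fin m) (i k : Fin n) : Prop :=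
  ∀ t ∈ T, ∀ l ∈ t.2, ColConn T i j l → (i ∈ t.1 ↔ k ∈ t.1)

/-- The tile made of the component of `j` in row `i` and of all rows similar to `i` along it. -/
def componentTile {n m : ℕ} (T : Set (Set (Fin n) × Set (Fin m))) (i : Fin n) (j : Fin m) :
    Set (Fin n) × Set (Fin m) :=
  ({k | RowSim T j i k}, {l | ColConn T i j l})

section

variable {n m : ℕ} {T : Set (Set (Fin n) × Set (Fin m))}

theorem ColConn.symm {i : Fin n} {j l : Fin m} (h : ColConn T i j l) : ColConn T i l j :=
  have : Std.Symm (ColAdj T i) := ⟨fun _ _ ⟨t, ht, hi, hj, hl⟩ => ⟨t, ht, hi, hl, hj⟩⟩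
  Relation.ReflTransGen.stdSymm.symm _ _ h

theorem ColConn.trans {i : Fin n} {j l p : Fin m} (h : ColConn T i j l) (h' : ColConn T i l p) :
    ColConn T i j p :=
  Relation.ReflTransGen.trans h h'

theorem RowSim.colConn_iff {j : Fin m} {i k : Fin n} (h : RowSim T j i k) (l : Fin m) :
    ColConn T i j l ↔ ColConn T k j l := by
  constructor
  · intro hl
    induction hl with
    | refl => exact .refl
    | tail hb hc ih =>
      obtain ⟨t, ht, hi, hb', hc'⟩ := hc
      exact ih.tail ⟨t, ht, (h t ht _ hb' hb).1 hi, hb', hc'⟩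
  · intro hl
    induction hl with
    | refl => exact .refl
    | tail hb hc ih =>
      obtain ⟨t, ht, hk, hb', hc'⟩ := hc
      exact ih.tail ⟨t, ht, (h t ht _ hb' ih).2 hk, hb', hc'⟩

theorem RowSim.rowSim_iff {j : Fin m} {i k : Fin n} (h : RowSim T j i k) (x : Fin n) :
    RowSim T j i x ↔ RowSim T j k x := by
  constructor
  · intro hx t ht l hl hc
    have hc' := (h.colConn_iff l).2 hc
    exact (h t ht l hl hc').symm.trans (hx t ht l hl hc')
  · intro hx t ht l hl hc
    exact (h t ht l hl hc).trans (hx t ht l hl ((h.colConn_iff l).1 hc))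

theorem componentTile_eq_of_rowSim {j : Fin m} {i k : Fin n} (h : RowSim T j i k) :
    componentTile T i j = componentTile T k j :=
  Prod.ext (Set.ext h.rowSim_iff) (Set.ext h.colConn_iff)

theorem componentTile_eq_of_colConn {k : Fin n} {j l : Fin m} (h : ColConn T k j l) :
    componentTile T k j = componentTile T k l := by
  have hc (x : Fin m) : ColConn T k j x ↔ ColConn T k l x := ⟨h.symm.trans, h.trans⟩
  refine Prod.ext (Set.ext fun x => ?_) (Set.ext hc)
  simp [componentTile, RowSim, hc]

theorem componentTile_eq_of_mem {i k : Fin n} {j l : Fin m}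
    (hk : k ∈ (componentTile T i j).1) (hl : l ∈ (componentTile T i j).2) :
    componentTile T i j = componentTile T k l :=
  (componentTile_eq_of_rowSim hk).trans
    (componentTile_eq_of_colConn ((RowSim.colConn_iff hk l).1 hl))

theorem allowedByTile.mem_iff {P : Fin m → Equiv.Perm (Fin n)} {t : Set (Fin n) × Set (Fin m)}
    (h : allowedByTile P t) {j : Fin m} (hj : j ∈ t.2) (i : Fin n) : i ∈ t.1 ↔ P j i ∈ t.1 := by
  have hm : Set.MapsTo (P j) t.1 t.1 := fun x hx => (h x j j hx hj hj).1
  refine ⟨fun hi => hm hi, fun hi => ?_⟩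
  obtain ⟨x, hx, hxi⟩ :=
    ((Set.toFinite t.1).injOn_iff_bijOn_of_mapsTo hm).1 (P j).injective.injOn |>.surjOn hi
  rwa [← (P j).injective hxi]

theorem allowedBySet.apply_eq_of_colConn {P : Fin m → Equiv.Perm (Fin n)}
    (h : allowedBySet P T) {i : Fin n} {j l : Fin m} (hc : ColConn T i j l) : P j i = P l i := by
  induction hc with
  | refl => rfl
  | tail _ hc ih =>
    obtain ⟨t, ht, hi, hb, hc⟩ := hc
    exact ih.trans (h t ht _ _ _ hi hb hc).2

theorem allowedBySet.rowSim_apply {P : Fin m → Equiv.Perm (Fin n)}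
    (h : allowedBySet P T) (i : Fin n) (j : Fin m) : RowSim T j i (P j i) := by
  intro t ht l hl hc
  rw [h.apply_eq_of_colConn hc]
  exact (h t ht).mem_iff hl i

end

/-- For every finite set of possibly overlapping tiles `T`, there exists a tiling `𝒯`
(a finite set of pairwise non-overlapping tiles) that is equivalent to `T`. -/
theorem exists_equivalent_tiling (n m : ℕ) (hn : 0 < n) (hm : 0 < m)
    (T : Set (Set (Fin n) × Set (Fin m))) (hT : T.Finite) :
    ∃ 𝒯 : Set (Set (Fin n) × Set (Fin m)), 𝒯.Finite ∧
      (∀ t ∈ 𝒯, ∀ t' ∈ 𝒯, t ≠ t' → ¬ TilesOverlap t t') ∧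
      (∀ P : Fin m → Equiv.Perm (Fin n), allowedBySet P 𝒯 ↔ allowedBySet P T) := by
  refine ⟨Set.range fun x : Fin n × Fin m => componentTile T x.1 x.2, Set.finite_range _, ?_,
    fun P => ⟨?_, ?_⟩⟩
  · rintro _ ⟨⟨i, j⟩, rfl⟩ _ ⟨⟨i', j'⟩, rfl⟩ hne ⟨⟨k, hk, hk'⟩, ⟨l, hl, hl'⟩⟩
    exact hne ((componentTile_eq_of_mem hk hl).trans (componentTile_eq_of_mem hk' hl').symm)
  · intro h t ht i j j' hi hj hj'
    have hii : RowSim T j i i := fun _ _ _ _ _ => Iff.rfl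
    have hjj' : ColConn T i j j' := .single ⟨t, ht, hi, hj, hj'⟩
    obtain ⟨hs, he⟩ := h (componentTile T i j) ⟨(i, j), rfl⟩ i j j' hii .refl hjj'
    exact ⟨(hs t ht j hj .refl).1 hi, he⟩
  · rintro h _ ⟨⟨i₀, j₀⟩, rfl⟩ i j j' hi hj hj'
    dsimp only at hi hj hj' ⊢
    rw [componentTile_eq_of_mem hi hj] at hj' ⊢
    exact ⟨h.rowSim_apply i j, h.apply_eq_of_colConn hj'⟩
end

section
/- Let X be an n × m real matrix with centered matrix Y, and let 𝒯 be the fully-unconstrained tiling consisting of the tiles ([n], {j}) for each j ∈ [m]. Then for all j, j' ∈ [m] with j ≠ j', the covariance of columns j and j' under 𝒯 is zero: cov(j, j') = 0. -/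
open scoped Classical

/-- The centered data matrix `Y(i, l) = X(i, l) − (1/n)·Σ_k X(k, l)`. -/
noncomputable def centered {n m : ℕ} (X : Fin n → Fin m → ℝ) (i : Fin n) (l : Fin m) : ℝ :=
  X i l - (∑ k, X k l) / n

/-- The finite set of vectors of permutations allowed by a set of tiles. -/
noncomputable def allowedFinset (n m : ℕ) (𝒯 : Set (Set (Fin n) × Set (Fin m))) :
    Finset (Fin m → Equiv.Perm (Fin n)) :=
  Finset.univ.filter (fun P => allowedBySet P 𝒯)

/-- The covariance of columns `j, j'` under the tiling `𝒯`: the uniform average over all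
allowed vectors of permutations of `(1/n)·Σ_i Y(π_j(i), j)·Y(π_{j'}(i), j')`. -/
noncomputable def cov {n m : ℕ} (X : Fin n → Fin m → ℝ)
    (𝒯 : Set (Set (Fin n) × Set (Fin m))) (j j' : Fin m) : ℝ :=
  (∑ P ∈ allowedFinset n m 𝒯,
      (∑ i, centered X (P j i) j * centered X (P j' i) j') / n) /
    (allowedFinset n m 𝒯).card

/-- The columns of the centered data matrix sum to zero. -/
theorem sum_centered_eq_zero {n m : ℕ} (X : Fin n → Fin m → ℝ) (l : Fin m) :
    ∑ k, centered X k l = 0 := by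
  rcases Nat.eq_zero_or_pos n with rfl | hn
  · simp
  · have hn' : (n : ℝ) ≠ 0 := by positivity
    simp only [centered, Finset.sum_sub_distrib, Finset.sum_const, Finset.card_univ,
      Fintype.card_fin, nsmul_eq_mul]
    field_simp
    ring

/-- Every vector of permutations is allowed by the fully-unconstrained tiling. -/
theorem allowedFinset_fully_unconstrained (n m : ℕ) :
    allowedFinset n m {t : Set (Fin n) × Set (Fin m) |
        ∃ l : Fin m, t = ((Set.univ : Set (Fin n)), ({l} : Set (Fin m)))} = Finset.univ := by
  refine Finset.filter_true_of_mem fun P _ => ?_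
  rintro t ⟨l, rfl⟩ i a b - (rfl : a = l) (rfl : b = a)
  exact ⟨Set.mem_univ _, rfl⟩

/-- Independent uniform permutations of distinct columns decorrelate a function with zero sum
from any other function. -/
theorem sum_perm_mul_eq_zero {n : ℕ} {ι : Type*} [Fintype ι] [DecidableEq ι] {j j' : ι}
    (hjj' : j ≠ j') (f g : Fin n → ℝ) (hf : ∑ k, f k = 0) (i : Fin n) :
    ∑ P : ι → Equiv.Perm (Fin n), f (P j i) * g (P j' i) = 0 := by
  have : NeZero n := ⟨i.pos.ne'⟩
  have hshift (k : Fin n) : ∑ P : ι → Equiv.Perm (Fin n), f (P j i + k) * g (P j' i) =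
      ∑ P : ι → Equiv.Perm (Fin n), f (P j i) * g (P j' i) := by
    rw [← Equiv.sum_comp (Equiv.mulLeft (Pi.mulSingle j (Equiv.addRight k)))
      fun P : ι → Equiv.Perm (Fin n) => f (P j i) * g (P j' i)]
    simp [Pi.mulSingle_eq_of_ne hjj'.symm]
  have hsum : ∑ k : Fin n, ∑ P : ι → Equiv.Perm (Fin n), f (P j i + k) * g (P j' i) = 0 := by
    rw [Finset.sum_comm]
    refine Finset.sum_eq_zero fun P _ => ?_
    have hP : ∑ k, f (P j i + k) = 0 := (Equiv.sum_comp (Equiv.addLeft (P j i)) f).trans hf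
    rw [← Finset.sum_mul, hP, zero_mul]
  simpa [hshift, NeZero.ne n] using hsum

/-- Under the fully-unconstrained tiling `{([n], {j}) : j ∈ [m]}`, the covariance of two
distinct columns `j ≠ j'` is zero. -/
theorem cov_fully_unconstrained_offdiag (n m : ℕ) (hn : 0 < n) (hm : 0 < m)
    (X : Fin n → Fin m → ℝ) (j j' : Fin m) (hjj' : j ≠ j') :
    cov X {t : Set (Fin n) × Set (Fin m) |
        ∃ l : Fin m, t = ((Set.univ : Set (Fin n)), ({l} : Set (Fin m)))} j j' = 0 := by
  rw [cov, allowedFinset_fully_unconstrained, ← Finset.sum_div, Finset.sum_comm,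
    Finset.sum_eq_zero fun i _ => sum_perm_mul_eq_zero hjj' (centered X · j) (centered X · j')
      (sum_centered_eq_zero X j) i, zero_div, zero_div]
end
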